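/- Let τₙ be a uniformly random permutation of {1,…,n} for each n. Then (LAₙ(τₙ) − 2n/3)/√(8n/45) converges in distribution, as n → ∞, to a standard normal random variable. -/

import Mathlib

open MeasureTheory ProbabilityTheory Filter Finset

noncomputable section

attribute [local instance] Classical.propDecidable

/-- A list of values is alternating (starting with a descent):
`l 0 > l 1 < l 2 > l 3 < ⋯`. -/
def IsAltList {α : Type*} [LT α] (l : List α) : Prop :=
  ∀ i : ℕ, ∀ h : i + 1 < l.length,
    if i % 2 = 0 then l[i+1]'h < l[i]'(Nat.lt_of_succ_lt h)
    else l[i]'(Nat.lt_of_succ_lt h) < l[i+1]'h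

/-- The length of the longest alternating subsequence of the finite sequence
`a : Fin n → α`. -/
def LAfin {α : Type*} [LinearOrder α] {n : ℕ} (a : Fin n → α) : ℕ :=
  sSup {m | ∃ l : List (Fin n), l.length = m ∧ l.Chain' (· < ·) ∧ IsAltList (l.map a)}

/-- `IsZigzag d x l` says that `x :: l` alternates, its first step being an ascent when `d` is
`true` and a descent when `d` is `false`. -/
def IsZigzag {α : Type*} [LT α] : Bool → α → List α → Prop
  | _, _, [] => True
  | true, x, y :: l => x < y ∧ IsZigzag false y l
  | false, x, y :: l => y < x ∧ IsZigzag true y l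

/-- The number of changes of direction in the word `x :: l`, read as if `x` had been reached by
an ascent when `d` is `true`, and by a descent when `d` is `false`. -/
def turns {α : Type*} [LT α] : Bool → α → List α → ℕ
  | _, _, [] => 0
  | true, x, y :: l => if x < y then turns true y l else 1 + turns false y l
  | false, x, y :: l => if y < x then turns false y l else 1 + turns true y l

/-- The number of monotone runs of a word preceded by a letter smaller than all others. -/
def upRuns {α : Type*} [LT α] : List α → ℕ
  | [] => 0
  | x :: l => 1 + turns true x l

section Greedy

variable {α : Type*} [LinearOrder α]

lemma isZigzag_iff_getElem (d : Bool) (x : α) (l : List α) :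
    IsZigzag d x l ↔ ∀ i : ℕ, ∀ h : i + 1 < (x :: l).length,
      if (i % 2 = 0 ↔ d = false)
      then (x :: l)[i+1]'h < (x :: l)[i]'(Nat.lt_of_succ_lt h)
      else (x :: l)[i]'(Nat.lt_of_succ_lt h) < (x :: l)[i+1]'h := by
  induction l generalizing d x with
  | nil => simp [IsZigzag]
  | cons y l ih =>
    have key : ∀ j : ℕ, ((j + 1) % 2 = 0 ↔ d = false) ↔ (j % 2 = 0 ↔ (!d) = false) := by
      intro j
      cases d <;> simp <;> omega
    have hstep : IsZigzag d x (y :: l) ↔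
        (if (0 % 2 = 0 ↔ d = false) then y < x else x < y) ∧ IsZigzag (!d) y l := by
      cases d <;> simp [IsZigzag]
    rw [hstep, ih]
    constructor
    · rintro ⟨h0, h⟩ (_ | j) hj
      · simpa using h0
      · have := h j (by simpa using hj)
        rw [if_congr (key j) rfl rfl]
        exact this
    · intro h
      refine ⟨by simpa using h 0 (by simp), fun j hj => ?_⟩
      have := h (j + 1) (by simpa using hj)
      rw [if_congr (key j) rfl rfl] at this
      exact this

lemma isAltList_cons_iff (x : α) (l : List α) : IsAltList (x :: l) ↔ IsZigzag false x l := by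
  rw [isZigzag_iff_getElem]
  simp [IsAltList]

lemma length_le_turns (d : Bool) (x : α) (l : List α) (w : α) (s : List α)
    (hs : (w :: s).Sublist (x :: l)) (hz : IsZigzag (!d) w s) : s.length ≤ turns d x l := by
  induction l generalizing d x w s with
  | nil =>
    have := hs.length_le
    simp at this
    simp [this]
  | cons y l ih =>
    have tail : ∀ e : Bool, IsZigzag e w s → s.Sublist (y :: l) → s.length ≤ 1 + turns e y l := by
      intro e he hsub
      cases s with
      | nil => simp
      | cons v s =>
        have : IsZigzag (!e) v s := by cases e <;> exact he.2
        have := ih e y v s hsub this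
        simp; omega
    have hsub : s.Sublist (y :: l) := by
      cases hs with
      | cons _ h => exact (List.sublist_cons_self w s).trans h
      | cons_cons _ h => exact h
    cases d
    · by_cases hxy : y < x
      · simp only [turns, if_pos hxy]
        cases hs with
        | cons _ h => exact ih false y w s h hz
        | cons_cons _ h =>
          cases h with
          | cons _ h =>
            refine ih false y y s (h.cons_cons y) ?_
            cases s with
            | nil => trivial
            | cons v s => exact ⟨hxy.trans hz.1, hz.2⟩
          | cons_cons _ h => exact absurd hz.1 (not_lt.2 hxy.le)
      · simp only [turns, if_neg hxy]
        exact tail true hz hsub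
    · by_cases hxy : x < y
      · simp only [turns, if_pos hxy]
        cases hs with
        | cons _ h => exact ih true y w s h hz
        | cons_cons _ h =>
          cases h with
          | cons _ h =>
            refine ih true y y s (h.cons_cons y) ?_
            cases s with
            | nil => trivial
            | cons v s => exact ⟨hz.1.trans hxy, hz.2⟩
          | cons_cons _ h => exact absurd hz.1 (not_lt.2 hxy.le)
      · simp only [turns, if_neg hxy]
        exact tail false hz hsub

lemma exists_isZigzag_length_eq_turns (d : Bool) (x : α) (l : List α) (hl : (x :: l).Nodup) :
    ∃ w s, (w :: s).Sublist (x :: l) ∧ (if d = true then x ≤ w else w ≤ x) ∧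
      IsZigzag (!d) w s ∧ s.length = turns d x l := by
  induction l generalizing d x with
  | nil => exact ⟨x, [], by simp, by simp, by simp [IsZigzag], by simp [turns]⟩
  | cons y l ih =>
    have hyx : y ≠ x := by
      rintro rfl
      simp at hl
    have hl' : (y :: l).Nodup := (List.nodup_cons.1 hl).2
    cases d
    · by_cases hxy : y < x
      · obtain ⟨w, s, h1, h2, h3, h4⟩ := ih false y hl'
        refine ⟨w, s, h1.cons x, ?_, h3, by simp [turns, hxy, h4]⟩
        simp at h2 ⊢
        exact h2.trans hxy.le
      · obtain ⟨w, s, h1, h2, h3, h4⟩ := ih true y hl'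
        refine ⟨x, w :: s, h1.cons_cons x, by simp, ⟨?_, h3⟩, by simp [turns, hxy, h4, add_comm]⟩
        simp at h2
        exact (lt_of_le_of_ne (not_lt.1 hxy) hyx.symm).trans_le h2
    · by_cases hxy : x < y
      · obtain ⟨w, s, h1, h2, h3, h4⟩ := ih true y hl'
        refine ⟨w, s, h1.cons x, ?_, h3, by simp [turns, hxy, h4]⟩
        simp at h2 ⊢
        exact hxy.le.trans h2
      · obtain ⟨w, s, h1, h2, h3, h4⟩ := ih false y hl'
        refine ⟨x, w :: s, h1.cons_cons x, by simp, ⟨?_, h3⟩, by simp [turns, hxy, h4, add_comm]⟩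
        simp at h2
        exact h2.trans_lt (lt_of_le_of_ne (not_lt.1 hxy) hyx)

lemma isGreatest_upRuns (l : List α) (hl : l.Nodup) :
    IsGreatest {m | ∃ s : List α, s.Sublist l ∧ IsAltList s ∧ s.length = m} (upRuns l) := by
  constructor
  · cases l with
    | nil => exact ⟨[], by simp, by simp [IsAltList], rfl⟩
    | cons x l =>
      obtain ⟨w, s, h1, -, h3, h4⟩ := exists_isZigzag_length_eq_turns true x l hl
      exact ⟨w :: s, h1, (isAltList_cons_iff w s).2 h3, by simp [upRuns, h4, add_comm]⟩
  · rintro m ⟨s, hs, ha, rfl⟩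
    cases l with
    | nil => simp [List.sublist_nil.1 hs]
    | cons x l =>
      cases s with
      | nil => simp
      | cons w s =>
        have := length_le_turns true x l w s hs ((isAltList_cons_iff w s).1 ha)
        simp [upRuns]; omega

lemma LAfin_eq_upRuns {n : ℕ} (a : Fin n → α) (ha : Function.Injective a) :
    LAfin a = upRuns (List.ofFn a) := by
  have h := isGreatest_upRuns (List.ofFn a) (List.nodup_ofFn.2 ha)
  rw [LAfin, ← h.csSup_eq]
  congr 1
  ext m
  constructor
  · rintro ⟨l, rfl, hc, hl⟩
    refine ⟨l.map a, ?_, hl, by simp⟩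
    have hp : (l.map (Fin.cast (List.length_ofFn (f := a)).symm)).Pairwise (· < ·) := by
      rw [List.pairwise_map]
      exact (List.isChain_iff_pairwise.1 hc).imp (fun h => by simpa using h)
    simpa [Function.comp_def] using List.map_getElem_sublist hp
  · rintro ⟨s, hs, hA, rfl⟩
    obtain ⟨is, rfl, hp⟩ := List.sublist_eq_map_getElem hs
    refine ⟨is.map (Fin.cast List.length_ofFn), by simp, ?_, ?_⟩
    · apply List.isChain_iff_pairwise.2
      rw [List.pairwise_map]
      exact hp.imp (fun h => by simpa using h)
    · simp only [Fin.getElem_fin, List.getElem_ofFn] at hA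
      rwa [List.map_map]

end Greedy

lemma upRuns_map {α β : Type*} [LinearOrder α] [LinearOrder β] {f : α → β} (hf : StrictMono f)
    (l : List α) : upRuns (l.map f) = upRuns l := by
  have h : ∀ (l : List α) (d : Bool) (x : α), turns d (f x) (l.map f) = turns d x l := by
    intro l
    induction l with
    | nil => intro d x; simp [turns]
    | cons y l ih => intro d x; cases d <;> simp [turns, hf.lt_iff_lt, ih]
  cases l with
  | nil => rfl
  | cons x l => simp [upRuns, h]

section Insertion

variable {α : Type*} [LinearOrder α] {R : Type*} [CommRing R]

lemma sum_turns_permutations'Aux (M : α) (l : List α) (x : α) (hl : (x :: l).Nodup)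
    (hM : ∀ y ∈ x :: l, y < M) (g : ℕ → R) :
    ((l.permutations'Aux M).map (fun s => g (turns false x s))).sum =
        turns false x l * g (turns false x l) + g (turns false x l + 1)
          + (l.length - turns false x l) * g (turns false x l + 2) ∧
      g (1 + turns false x l) + ((l.permutations'Aux M).map (fun s => g (turns true x s))).sum =
        (turns true x l + 1) * g (turns true x l) + g (turns true x l + 1)
          + (l.length - turns true x l) * g (turns true x l + 2) := by
  induction l generalizing x g with
  | nil =>
    have hx : x < M := hM x (by simp)
    simp [turns, hx, hx.not_gt]
    ring
  | cons y l ih =>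
    have hx : x < M := hM x (by simp)
    have hy : y < M := hM y (by simp)
    have hyx : x ≠ y := by
      rintro rfl
      simp at hl
    have ih' := ih y (List.nodup_cons.1 hl).2 (fun z hz => hM z (List.mem_cons_of_mem _ hz))
    rcases lt_or_gt_of_ne hyx with h | h
    · have h1 := (ih' fun k => g (1 + k)).2
      have h2 := (ih' g).2
      simp only [List.permutations'Aux, List.map_cons, List.map_map, Function.comp_def,
        List.sum_cons, turns, hx, hx.not_gt, hy, hy.not_gt, h, h.not_gt, if_true, if_false,
        List.length_cons, Nat.cast_add, Nat.cast_one]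
      constructor
      · rw [h1]
        simp only [add_comm, add_left_comm, add_assoc]
        norm_num
      · rw [h2]
        simp only [add_comm, add_left_comm, add_assoc]
        norm_num
        ring
    · have h1 := (ih' fun k => g (1 + k)).1
      have h2 := (ih' g).1
      simp only [List.permutations'Aux, List.map_cons, List.map_map, Function.comp_def,
        List.sum_cons, turns, hx, hx.not_gt, hy, hy.not_gt, h, h.not_gt, if_true, if_false,
        List.length_cons, Nat.cast_add, Nat.cast_one]
      constructor
      · rw [h2]
        simp only [add_comm, add_left_comm, add_assoc]
        norm_num
        ring
      · rw [h1]
        simp only [add_comm, add_left_comm, add_assoc]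
        norm_num
        ring

lemma sum_upRuns_permutations'Aux (M : α) (l : List α) (hl : l.Nodup) (hM : ∀ y ∈ l, y < M)
    (g : ℕ → R) :
    ((l.permutations'Aux M).map (fun s => g (upRuns s))).sum =
      upRuns l * g (upRuns l) + g (upRuns l + 1) + (l.length - upRuns l) * g (upRuns l + 2) := by
  cases l with
  | nil => simp [upRuns, turns]
  | cons x l =>
    have h := (sum_turns_permutations'Aux M l x hl hM (fun k => g (1 + k))).2
    have hx : x < M := hM x (by simp)
    simp only [List.permutations'Aux, List.map_cons, List.map_map, Function.comp_def,
      List.sum_cons, upRuns, turns, hx.not_gt, if_false, List.length_cons, Nat.cast_add,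
      Nat.cast_one]
    rw [h]
    simp only [add_comm, add_left_comm, add_assoc]
    norm_num

lemma sum_upRuns_permutations'_cons (M : α) (L : List α) (hL : L.Nodup) (hM : ∀ y ∈ L, y < M)
    (g : ℕ → R) :
    (((M :: L).permutations').map (fun s => g (upRuns s))).sum =
      (L.permutations'.map (fun s => upRuns s * g (upRuns s) + g (upRuns s + 1)
        + (L.length - upRuns s) * g (upRuns s + 2))).sum := by
  have hsum (P : List (List α)) (f : List α → List (List α)) (h : List α → R) :
      ((P.flatMap f).map h).sum = (P.map (fun s => ((f s).map h).sum)).sum := by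
    induction P with
    | nil => simp
    | cons s P ih => simp [ih]
  rw [List.permutations', hsum]
  congr 1
  refine List.map_congr_left fun s hs => ?_
  have hp := List.mem_permutations'.1 hs
  rw [sum_upRuns_permutations'Aux M s (hp.nodup_iff.2 hL) (fun y hy => hM y (hp.mem_iff.1 hy)),
    hp.length_eq]

end Insertion

/-- The length of the longest alternating subsequence of a permutation. -/
def permLA {n : ℕ} (τ : Equiv.Perm (Fin n)) : ℕ := LAfin (fun i => τ i)

lemma permLA_eq {n : ℕ} (τ : Equiv.Perm (Fin n)) :
    permLA τ = upRuns (List.ofFn (fun i => (τ i : ℕ))) := by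
  rw [permLA, LAfin_eq_upRuns _ τ.injective, ← upRuns_map Fin.val_strictMono, List.map_ofFn]
  rfl

lemma sum_perm_eq_sum_permutations' {R : Type*} [CommRing R] (n : ℕ) (g : List ℕ → R) :
    ∑ τ : Equiv.Perm (Fin n), g (List.ofFn (fun i => (τ i : ℕ))) =
      ((List.range n).reverse.permutations'.map g).sum := by
  have hnd : (List.range n).reverse.Nodup := List.nodup_reverse.2 List.nodup_range
  have hnd' : (List.range n).reverse.permutations'.Nodup :=
    (List.permutations_perm_permutations' _).nodup_iff.1 (List.nodup_permutations _ hnd)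
  have hinj : Function.Injective
      (fun τ : Equiv.Perm (Fin n) => List.ofFn (fun i => (τ i : ℕ))) := by
    intro σ τ h
    have := List.ofFn_injective h
    ext i
    exact congrFun this i
  rw [← List.sum_toFinset _ hnd',
    ← Finset.sum_image (f := g) (g := fun τ : Equiv.Perm (Fin n) => List.ofFn (fun i => (τ i : ℕ)))
      hinj.injOn]
  refine Finset.sum_congr (Finset.eq_of_subset_of_card_le ?_ ?_) fun _ _ => rfl
  · intro l hl
    obtain ⟨τ, -, rfl⟩ := Finset.mem_image.1 hl
    rw [List.mem_toFinset, List.mem_permutations']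
    refine (List.perm_ext_iff_of_nodup
      (List.nodup_ofFn.2 (Fin.val_injective.comp τ.injective)) hnd).2 fun a => ?_
    simp only [List.mem_ofFn, List.mem_reverse, List.mem_range]
    constructor
    · rintro ⟨i, rfl⟩
      exact (τ i).2
    · intro h
      exact ⟨τ.symm ⟨a, h⟩, by simp⟩
  · rw [Finset.card_image_of_injective _ hinj, List.toFinset_card_of_nodup hnd',
      ← (List.permutations_perm_permutations' _).length_eq, List.length_permutations]
    simp [Fintype.card_perm]

lemma permLA_le {n : ℕ} (τ : Equiv.Perm (Fin n)) : permLA τ ≤ n := by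
  rw [permLA_eq]
  obtain ⟨s, hs, -, h⟩ := (isGreatest_upRuns (List.ofFn (fun i => (τ i : ℕ)))
    (List.nodup_ofFn.2 (Fin.val_injective.comp τ.injective))).1
  rw [← h]
  simpa using hs.length_le

/-- Inserting the largest value at all possible positions of a permutation of `n` letters whose
longest alternating subsequence has length `k` keeps this length in `k` cases, raises it by one in
one case, and by two in the `n - k` remaining cases. -/
lemma sum_permLA_succ {R : Type*} [CommRing R] (n : ℕ) (g : ℕ → R) :
    ∑ σ : Equiv.Perm (Fin (n + 1)), g (permLA σ) =
      ∑ τ : Equiv.Perm (Fin n), (permLA τ * g (permLA τ) + g (permLA τ + 1)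
        + (n - permLA τ) * g (permLA τ + 2)) := by
  simp only [permLA_eq]
  rw [sum_perm_eq_sum_permutations' (n + 1) (fun l => g (upRuns l)),
    sum_perm_eq_sum_permutations' n (fun l => upRuns l * g (upRuns l) + g (upRuns l + 1)
        + (n - upRuns l) * g (upRuns l + 2)),
    List.range_succ, List.reverse_append, List.reverse_singleton, List.singleton_append,
    sum_upRuns_permutations'_cons _ _ (List.nodup_reverse.2 List.nodup_range) (by simp)]
  simp

/-- The average of `h (permLA τ)` over the permutations `τ` of `n` letters. -/
def permAvg {K : Type*} [Field K] (n : ℕ) (h : ℕ → K) : K :=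
  (∑ τ : Equiv.Perm (Fin n), h (permLA τ)) / n.factorial

section Average

lemma permAvg_succ {K : Type*} [Field K] [CharZero K] (n : ℕ) (h : ℕ → K) :
    permAvg (n + 1) h =
      permAvg n (fun k => (k * h k + h (k + 1) + (n - k) * h (k + 2)) / (n + 1)) := by
  have h1 : (n.factorial : K) ≠ 0 := by exact_mod_cast n.factorial_ne_zero
  have h2 : (n : K) + 1 ≠ 0 := by exact_mod_cast n.succ_ne_zero
  rw [permAvg, permAvg, sum_permLA_succ, ← Finset.sum_div, Nat.factorial_succ]
  push_cast
  field_simp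

lemma permAvg_const {K : Type*} [Field K] [CharZero K] (n : ℕ) (c : K) :
    permAvg n (fun _ => c) = c := by
  have h1 : (n.factorial : K) ≠ 0 := by exact_mod_cast n.factorial_ne_zero
  simp [permAvg, Fintype.card_perm]
  field_simp

lemma permAvg_add {K : Type*} [Field K] (n : ℕ) (f g : ℕ → K) :
    permAvg n (fun k => f k + g k) = permAvg n f + permAvg n g := by
  simp [permAvg, Finset.sum_add_distrib, add_div]

lemma permAvg_sub {K : Type*} [Field K] (n : ℕ) (f g : ℕ → K) :
    permAvg n (fun k => f k - g k) = permAvg n f - permAvg n g := by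
  simp [permAvg, Finset.sum_sub_distrib, sub_div]

lemma permAvg_const_mul {K : Type*} [Field K] (n : ℕ) (c : K) (f : ℕ → K) :
    permAvg n (fun k => c * f k) = c * permAvg n f := by
  simp [permAvg, ← Finset.mul_sum, mul_div_assoc]

lemma permAvg_mono {n : ℕ} {f g : ℕ → ℝ} (h : ∀ k ≤ n, f k ≤ g k) :
    permAvg n f ≤ permAvg n g := by
  unfold permAvg
  gcongr with τ
  exact h _ (permLA_le τ)

lemma norm_permAvg_le {n : ℕ} {f : ℕ → ℂ} {g : ℕ → ℝ} (h : ∀ k ≤ n, ‖f k‖ ≤ g k) :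
    ‖permAvg n f‖ ≤ permAvg n g := by
  unfold permAvg
  rw [norm_div, Complex.norm_natCast]
  gcongr
  exact norm_sum_le_of_le _ fun τ _ => h _ (permLA_le τ)

end Average

section Moments

/-- The deviation of `k` from the (asymptotic) mean `2 n / 3 + 1 / 6` of `permLA`. -/
def dev (n k : ℕ) : ℝ := k - (2 * n / 3 + 1 / 6)

lemma abs_dev_le {n k : ℕ} (hk : k ≤ n) : |dev n k| ≤ n + 1 := by
  have h1 : (k : ℝ) ≤ n := by exact_mod_cast hk
  have h2 : (0 : ℝ) ≤ k := k.cast_nonneg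
  rw [dev, abs_le]
  constructor <;> linarith

lemma permAvg_dev_sq_le (n : ℕ) : permAvg n (fun k => dev n k ^ 2) ≤ 2 * n + 1 := by
  induction n with
  | zero =>
    calc permAvg 0 (fun k => dev 0 k ^ 2) ≤ permAvg 0 (fun _ => (1 : ℝ)) := by
          refine permAvg_mono fun k hk => ?_
          obtain rfl : k = 0 := by omega
          norm_num [dev]
      _ = _ := by rw [permAvg_const]; simp
  | succ n ih =>
    rw [permAvg_succ]
    calc _ ≤ permAvg n (fun k => dev n k ^ 2 + 2) := by
          refine permAvg_mono fun k hk => ?_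
          have h2 : (0 : ℝ) ≤ k := k.cast_nonneg
          rw [div_le_iff₀ (by positivity)]
          simp only [dev]
          push_cast
          nlinarith [sq_nonneg ((k : ℝ) - (2 * n / 3 + 1 / 6))]
      _ ≤ _ := by
          rw [permAvg_add, permAvg_const]
          push_cast
          linarith

lemma permAvg_abs_dev_le (n : ℕ) : permAvg n (fun k => |dev n k|) ≤ 3 / 2 * √(n + 1) := by
  have hr : 0 < √((n : ℝ) + 1) := by positivity
  have hsq : √((n : ℝ) + 1) ^ 2 = n + 1 := Real.sq_sqrt (by positivity)
  set r := √((n : ℝ) + 1)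
  calc permAvg n (fun k => |dev n k|)
      ≤ permAvg n (fun k => 1 / (2 * r) * dev n k ^ 2 + r / 2) := by
        refine permAvg_mono fun k _ => ?_
        have : 1 / (2 * r) * dev n k ^ 2 + r / 2 - |dev n k| = (|dev n k| - r) ^ 2 / (2 * r) := by
          rw [← sq_abs (dev n k)]
          field_simp
          ring
        have h2 : 0 ≤ (|dev n k| - r) ^ 2 / (2 * r) := by positivity
        linarith
    _ = 1 / (2 * r) * permAvg n (fun k => dev n k ^ 2) + r / 2 := by
        rw [permAvg_add, permAvg_const_mul, permAvg_const]
    _ ≤ 1 / (2 * r) * (2 * r ^ 2) + r / 2 := by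
        gcongr
        have := permAvg_dev_sq_le n
        linarith
    _ = 3 / 2 * r := by
        field_simp
        ring

end Moments

section CharacteristicFunction

open Complex (I)

lemma norm_exp_mul_I_sub_taylor_le {c s : ℝ} (hc : |c| ≤ 4 / 3) (hs : |s| ≤ 1 / 3) :
    ‖Complex.exp ((s * c : ℝ) * I) - (1 + (s * c : ℝ) * I - ((s * c) ^ 2 / 2 : ℝ))‖ ≤ |s| ^ 3 := by
  have hx : ‖((s * c : ℝ) : ℂ) * I‖ = |s| * |c| := by
    rw [norm_mul, Complex.norm_I, mul_one, Complex.norm_real, Real.norm_eq_abs, abs_mul]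
  have hle : |s| * |c| ≤ |s| * (4 / 3) := by gcongr
  have h := Complex.exp_bound (x := ((s * c : ℝ) : ℂ) * I) (n := 3) (by rw [hx]; linarith)
    (by norm_num)
  rw [hx] at h
  have hpow : (|s| * |c|) ^ 3 ≤ (|s| * (4 / 3)) ^ 3 := by gcongr
  have hsum : ∑ m ∈ Finset.range 3, (((s * c : ℝ) : ℂ) * I) ^ m / m.factorial =
      1 + (s * c : ℝ) * I - ((s * c) ^ 2 / 2 : ℝ) := by
    simp only [Finset.sum_range_succ, Finset.sum_range_zero, mul_pow, Complex.I_sq]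
    norm_num [Nat.factorial]
    ring
  rw [hsum] at h
  refine h.trans ?_
  norm_num [Nat.factorial]
  nlinarith [pow_nonneg (abs_nonneg s) 3]

/-- The conditional characteristic function of one step of the insertion chain, compared with a
Gaussian step of variance `8 / 9`. -/
lemma norm_step_sub_exp_le {n k : ℕ} (hk : k ≤ n) {s : ℝ} (hs : |s| ≤ 1 / 3) :
    ‖(k * Complex.exp ((s * (-2 / 3) : ℝ) * I) + Complex.exp ((s * (1 / 3) : ℝ) * I)
          + (n - k) * Complex.exp ((s * (4 / 3) : ℝ) * I)) / (n + 1)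
        - Complex.exp ((s * (-2 * dev n k / (n + 1)) : ℝ) * I - (4 * s ^ 2 / 9 : ℝ))‖ ≤
      2 * |s| ^ 3 + s ^ 2 * (1 + |dev n k|) / (n + 1) + 4 * s ^ 2 / (n + 1) ^ 2 * dev n k ^ 2 := by
  have hn : (0 : ℝ) < n + 1 := by positivity
  have hkn : (k : ℝ) ≤ n := by exact_mod_cast hk
  set X := dev n k
  have hXdef : X = k - (2 * n / 3 + 1 / 6) := rfl
  set b : ℝ := -2 * X / (n + 1) with hb
  have hb2 : |b| ≤ 2 := by
    rw [hb, abs_div, abs_mul, abs_of_pos hn, div_le_iff₀ hn]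
    norm_num
    exact abs_dev_le hk
  set z : ℂ := (s * b : ℝ) * I - (4 * s ^ 2 / 9 : ℝ) with hz
  set T : ℝ → ℂ := fun c => 1 + (s * c : ℝ) * I - ((s * c) ^ 2 / 2 : ℝ) with hT
  set e : ℝ → ℂ := fun c => Complex.exp ((s * c : ℝ) * I)
  have hTe : ∀ c : ℝ, |c| ≤ 4 / 3 → ‖e c - T c‖ ≤ |s| ^ 3 := fun c hc =>
    norm_exp_mul_I_sub_taylor_le hc hs
  -- replacing the exponentials by their Taylor polynomials
  have h1 : ‖(k * e (-2 / 3) + e (1 / 3) + (n - k) * e (4 / 3)) / (n + 1)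
      - (k * T (-2 / 3) + T (1 / 3) + (n - k) * T (4 / 3)) / (n + 1)‖ ≤ |s| ^ 3 := by
    have : (k * e (-2 / 3) + e (1 / 3) + (n - k) * e (4 / 3)) / (n + 1)
        - (k * T (-2 / 3) + T (1 / 3) + (n - k) * T (4 / 3)) / (n + 1) =
        (((k : ℝ) : ℂ) * (e (-2 / 3) - T (-2 / 3)) + (e (1 / 3) - T (1 / 3))
          + ((n - k : ℝ) : ℂ) * (e (4 / 3) - T (4 / 3))) / ((n + 1 : ℝ) : ℂ) := by
      push_cast
      ring
    rw [this, norm_div, Complex.norm_real, Real.norm_of_nonneg hn.le, div_le_iff₀ hn]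
    calc _ ≤ ‖((k : ℝ) : ℂ) * (e (-2 / 3) - T (-2 / 3))‖ + ‖e (1 / 3) - T (1 / 3)‖
          + ‖((n - k : ℝ) : ℂ) * (e (4 / 3) - T (4 / 3))‖ := norm_add₃_le
      _ ≤ k * |s| ^ 3 + |s| ^ 3 + (n - k) * |s| ^ 3 := by
        rw [norm_mul, norm_mul, Complex.norm_real, Complex.norm_real,
          Real.norm_of_nonneg k.cast_nonneg, Real.norm_of_nonneg (sub_nonneg.2 hkn)]
        have := sub_nonneg.2 hkn
        gcongr
        · exact hTe _ (by norm_num [abs_le])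
        · exact hTe _ (by norm_num [abs_le])
        · exact hTe _ (by norm_num [abs_le])
      _ = |s| ^ 3 * (n + 1) := by ring
  -- the mean and the variance of the step
  have h2 : (k * T (-2 / 3) + T (1 / 3) + (n - k) * T (4 / 3)) / (n + 1) - (1 + z) =
      ((s ^ 2 / 2 * ((1 + 4 / 3 * X) / (n + 1)) : ℝ) : ℂ) := by
    simp only [hT, hz, hb, hXdef]
    push_cast
    field_simp
    ring
  have h2' : ‖(k * T (-2 / 3) + T (1 / 3) + (n - k) * T (4 / 3)) / (n + 1) - (1 + z)‖ ≤
      s ^ 2 * (1 + |X|) / (n + 1) := by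
    have h3 : |1 + 4 / 3 * X| ≤ 1 + 4 / 3 * |X| := by
      refine (abs_add_le _ _).trans ?_
      rw [abs_mul]
      norm_num
    rw [h2, Complex.norm_real, Real.norm_eq_abs, ← mul_div_assoc, abs_div, abs_of_pos hn, abs_mul,
      abs_of_nonneg (by positivity : 0 ≤ s ^ 2 / 2), div_mul_eq_mul_div, mul_div_assoc]
    gcongr
    linarith [abs_nonneg X]
  have hz2 : ‖z‖ ^ 2 = s ^ 2 * b ^ 2 + 16 * s ^ 4 / 81 := by
    have hre : z.re = -(4 * s ^ 2 / 9) := by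
      rw [hz, Complex.sub_re, Complex.re_ofReal_mul, Complex.I_re, Complex.ofReal_re]
      ring
    have him : z.im = s * b := by
      rw [hz, Complex.sub_im, Complex.im_ofReal_mul, Complex.I_im, Complex.ofReal_im]
      ring
    rw [← Complex.normSq_eq_norm_sq, Complex.normSq_apply, hre, him]
    ring
  have hs2 : s ^ 2 ≤ 1 / 9 := by
    rw [← sq_abs]
    nlinarith [abs_nonneg s]
  have hbsq : b ^ 2 ≤ 4 := by
    rw [← sq_abs]
    nlinarith [abs_nonneg b]
  have h3 : ‖Complex.exp z - (1 + z)‖ ≤ s ^ 2 * b ^ 2 + 16 * s ^ 4 / 81 := by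
    rw [← hz2, ← sub_sub]
    refine Complex.norm_exp_sub_one_sub_id_le ?_
    have : ‖z‖ ^ 2 ≤ 1 := by
      rw [hz2]
      nlinarith [sq_nonneg s, sq_nonneg b, mul_nonneg (sq_nonneg s) (sq_nonneg b)]
    nlinarith [norm_nonneg z]
  have h4 : 16 * s ^ 4 / 81 ≤ |s| ^ 3 := by
    have : s ^ 4 = |s| ^ 3 * |s| := by
      rw [← pow_succ, Even.pow_abs (by decide)]
    rw [this]
    nlinarith [pow_nonneg (abs_nonneg s) 3]
  have h5 : s ^ 2 * b ^ 2 = 4 * s ^ 2 / (n + 1) ^ 2 * X ^ 2 := by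
    rw [hb]
    field_simp
    ring
  calc _ ≤ ‖(k * e (-2 / 3) + e (1 / 3) + (n - k) * e (4 / 3)) / (n + 1)
      - (k * T (-2 / 3) + T (1 / 3) + (n - k) * T (4 / 3)) / (n + 1)‖
      + ‖(k * T (-2 / 3) + T (1 / 3) + (n - k) * T (4 / 3)) / (n + 1) - (1 + z)‖
      + ‖(1 + z) - Complex.exp z‖ :=
        (norm_sub_le_norm_sub_add_norm_sub _ _ _).trans
          (add_le_add_left (norm_sub_le_norm_sub_add_norm_sub _ _ _) _)
    _ ≤ _ := by
      rw [norm_sub_rev (1 + z)]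
      linarith

/-- The characteristic function of `permLA`, centred at `2 n / 3 + 1 / 6`. -/
def permCharFun (n : ℕ) (s : ℝ) : ℂ := permAvg n (fun k => Complex.exp ((s * dev n k : ℝ) * I))

lemma norm_permCharFun_succ_sub_le (n : ℕ) {s : ℝ} (hs : |s| ≤ 1 / 3) :
    ‖permCharFun (n + 1) s
        - Complex.exp (-(4 * s ^ 2 / 9) : ℝ) * permCharFun n (s * (n - 1) / (n + 1))‖ ≤
      2 * |s| ^ 3 + 11 * s ^ 2 / √(n + 1) := by
  have hn : (0 : ℝ) < n + 1 := by positivity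
  rw [permCharFun, permAvg_succ, permCharFun, ← permAvg_const_mul, ← permAvg_sub]
  have hr : 1 ≤ √((n : ℝ) + 1) := by
    rw [Real.one_le_sqrt]
    linarith [n.cast_nonneg (α := ℝ)]
  have hrsq : √((n : ℝ) + 1) ^ 2 = n + 1 := Real.sq_sqrt hn.le
  calc _ ≤ permAvg n (fun k => 2 * |s| ^ 3 + s ^ 2 / (n + 1) + s ^ 2 / (n + 1) * |dev n k|
          + 4 * s ^ 2 / (n + 1) ^ 2 * dev n k ^ 2) := by
        refine norm_permAvg_le fun k hk => ?_
        have hfac : ∀ c : ℝ, Complex.exp ((s * (dev n k + c) : ℝ) * I) =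
            Complex.exp ((s * dev n k : ℝ) * I) * Complex.exp ((s * c : ℝ) * I) := by
          intro c
          rw [← Complex.exp_add]
          push_cast
          ring_nf
        have e0 : dev (n + 1) k = dev n k + (-2 / 3) := by simp only [dev]; push_cast; ring
        have e1 : dev (n + 1) (k + 1) = dev n k + 1 / 3 := by simp only [dev]; push_cast; ring
        have e2 : dev (n + 1) (k + 2) = dev n k + 4 / 3 := by simp only [dev]; push_cast; ring
        have e3 : Complex.exp (-(4 * s ^ 2 / 9) : ℝ)
            * Complex.exp ((s * (n - 1) / (n + 1) * dev n k : ℝ) * I) =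
            Complex.exp ((s * dev n k : ℝ) * I)
              * Complex.exp ((s * (-2 * dev n k / (n + 1)) : ℝ) * I - (4 * s ^ 2 / 9 : ℝ)) := by
          rw [← Complex.exp_add, ← Complex.exp_add]
          congr 1
          push_cast
          field_simp
          ring
        rw [e0, e1, e2, e3, hfac, hfac, hfac]
        rw [show ∀ p q r a b c d : ℂ, (a * (d * p) + d * q + b * (d * r)) / c
            = d * ((a * p + q + b * r) / c) from fun p q r a b c d => by ring, ← mul_sub, norm_mul,
          Complex.norm_exp_ofReal_mul_I, one_mul]
        refine (norm_step_sub_exp_le hk hs).trans (le_of_eq ?_)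
        ring
    _ = 2 * |s| ^ 3 + s ^ 2 / (n + 1) + s ^ 2 / (n + 1) * permAvg n (fun k => |dev n k|)
          + 4 * s ^ 2 / (n + 1) ^ 2 * permAvg n (fun k => dev n k ^ 2) := by
        rw [permAvg_add, permAvg_add, permAvg_const_mul, permAvg_const_mul, permAvg_const]
    _ ≤ 2 * |s| ^ 3 + s ^ 2 / (n + 1) + s ^ 2 / (n + 1) * (3 / 2 * √(n + 1))
          + 4 * s ^ 2 / (n + 1) ^ 2 * (2 * (n + 1)) := by
        gcongr
        · exact permAvg_abs_dev_le n
        · linarith [permAvg_dev_sq_le n]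
    _ = 2 * |s| ^ 3 + s ^ 2 * (9 / √(n + 1) + 3 / 2) / √(n + 1) := by
        set r := √((n : ℝ) + 1)
        rw [← hrsq]
        field_simp
        ring
    _ ≤ _ := by
        have : 9 / √((n : ℝ) + 1) ≤ 9 := div_le_self (by norm_num) hr
        rw [mul_comm 11]
        gcongr
        linarith

lemma norm_permCharFun_sub_exp_le (θ σ : ℝ) (hσ : σ ≤ 1 / 3) (N : ℕ)
    (h : ∀ j ≤ N, |θ * (j * (j - 1))| ≤ σ) :
    ‖permCharFun N (θ * (N * (N - 1)))
        - Complex.exp (-(4 / 135 * θ ^ 2 * (N * (N ^ 2 - 1) * (3 * N ^ 2 - 2))) : ℝ)‖ ≤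
      2 * σ ^ 3 * N + 22 * σ ^ 2 * √N := by
  induction N with
  | zero => simp [permCharFun, permAvg_const]
  | succ n ih =>
    have ih := ih fun j hj => h j (by omega)
    set s : ℝ := θ * ((n + 1 : ℕ) * ((n + 1 : ℕ) - 1)) with hs
    have hsσ : |s| ≤ σ := h (n + 1) le_rfl
    have hσ0 : 0 ≤ σ := (abs_nonneg _).trans hsσ
    have hstep := norm_permCharFun_succ_sub_le n (hsσ.trans hσ)
    have hn : (0 : ℝ) < n + 1 := by positivity
    have harg : s * (n - 1) / (n + 1) = θ * (n * (n - 1)) := by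
      rw [hs]
      push_cast
      field_simp
      ring
    rw [harg] at hstep
    set a : ℝ := -(4 * s ^ 2 / 9) with ha
    set c : ℝ := -(4 / 135 * θ ^ 2 * (n * (n ^ 2 - 1) * (3 * n ^ 2 - 2))) with hc
    have hexp : Complex.exp ((-(4 / 135 * θ ^ 2 * ((n + 1 : ℕ) * ((n + 1 : ℕ) ^ 2 - 1)
        * (3 * (n + 1 : ℕ) ^ 2 - 2))) : ℝ)) = Complex.exp (a : ℂ) * Complex.exp (c : ℂ) := by
      rw [← Complex.exp_add, ← Complex.ofReal_add]
      congr 2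
      rw [ha, hc, hs]
      push_cast
      ring
    have hsq : s ^ 2 ≤ σ ^ 2 := by
      rw [← sq_abs]
      gcongr
    have hcube : |s| ^ 3 ≤ σ ^ 3 := by gcongr
    have hsqrt : 1 / √((n : ℝ) + 1) ≤ 2 * (√(n + 1) - √n) := by
      have h1 : √((n : ℝ) + 1) ^ 2 = n + 1 := Real.sq_sqrt hn.le
      have h2 : √(n : ℝ) ^ 2 = n := Real.sq_sqrt n.cast_nonneg
      rw [div_le_iff₀ (by positivity)]
      nlinarith [sq_nonneg (√((n : ℝ) + 1) - √n)]
    have ha1 : ‖Complex.exp (a : ℂ)‖ ≤ 1 := by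
      rw [← Complex.ofReal_exp, Complex.norm_real, Real.norm_of_nonneg (Real.exp_pos _).le,
        Real.exp_le_one_iff, ha]
      have := sq_nonneg s
      linarith
    rw [hexp]
    calc _ ≤ ‖permCharFun (n + 1) s - Complex.exp (a : ℂ) * permCharFun n (θ * (n * (n - 1)))‖
          + ‖Complex.exp (a : ℂ) * permCharFun n (θ * (n * (n - 1)))
            - Complex.exp (a : ℂ) * Complex.exp (c : ℂ)‖ := norm_sub_le_norm_sub_add_norm_sub _ _ _
      _ ≤ (2 * |s| ^ 3 + 11 * s ^ 2 / √(n + 1))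
          + 1 * (2 * σ ^ 3 * n + 22 * σ ^ 2 * √n) := by
        rw [← mul_sub, norm_mul]
        gcongr
      _ ≤ (2 * σ ^ 3 + 11 * σ ^ 2 * (2 * (√(n + 1) - √n)))
          + 1 * (2 * σ ^ 3 * n + 22 * σ ^ 2 * √n) := by
        rw [mul_div_assoc, mul_assoc 11, div_eq_mul_one_div (s ^ 2)]
        gcongr
      _ = _ := by
        push_cast
        ring

end CharacteristicFunction

/-- Pointwise convergence of the characteristic functions of the standardised `permLA`. -/
lemma tendsto_permCharFun (t : ℝ) :
    Tendsto (fun n : ℕ => permCharFun n (t / √(8 * n / 45))) atTop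
      (nhds (Complex.exp (-(t ^ 2 / 2) : ℝ))) := by
  have hinv : Tendsto (fun n : ℕ => ((n : ℝ))⁻¹) atTop (nhds 0) :=
    tendsto_inv_atTop_zero.comp tendsto_natCast_atTop_atTop
  have hσ : Tendsto (fun n : ℕ => |t / √(8 * n / 45)|) atTop (nhds 0) := by
    have h1 : Tendsto (fun n : ℕ => √(8 * (n : ℝ) / 45)) atTop atTop :=
      Real.tendsto_sqrt_atTop.comp
        ((tendsto_natCast_atTop_atTop.const_mul_atTop (by norm_num)).atTop_div_const (by norm_num))
    simpa using (h1.const_div_atTop t).abs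
  have hexp : Tendsto (fun n : ℕ => Complex.exp
      (-(t ^ 2 / 6 * ((1 + (n : ℝ)⁻¹) * (3 - 2 * (n : ℝ)⁻¹ ^ 2) / (1 - (n : ℝ)⁻¹))) : ℝ)) atTop
      (nhds (Complex.exp (-(t ^ 2 / 2) : ℝ))) := by
    have h1 : Tendsto (fun n : ℕ =>
        -(t ^ 2 / 6 * ((1 + (n : ℝ)⁻¹) * (3 - 2 * (n : ℝ)⁻¹ ^ 2) / (1 - (n : ℝ)⁻¹)))) atTop
        (nhds (-(t ^ 2 / 6 * ((1 + 0) * (3 - 2 * 0 ^ 2) / (1 - 0))))) := by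
      refine ((((hinv.const_add 1).mul (((hinv.pow 2).const_mul 2).const_sub 3)).div
        (hinv.const_sub 1) (by norm_num)).const_mul _).neg
    rw [show -(t ^ 2 / 6 * ((1 + 0) * (3 - 2 * 0 ^ 2) / (1 - 0))) = -(t ^ 2 / 2) by ring] at h1
    exact (Complex.continuous_exp.tendsto _).comp
      ((Complex.continuous_ofReal.tendsto _).comp h1)
  have herr : Tendsto (fun n : ℕ =>
      45 / 4 * t ^ 2 * |t / √(8 * n / 45)| + 495 / 4 * t ^ 2 * √((n : ℝ)⁻¹)) atTop (nhds 0) := by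
    have h2 : Tendsto (fun n : ℕ => √((n : ℝ)⁻¹)) atTop (nhds 0) := by
      have := (Real.continuous_sqrt.tendsto 0).comp hinv
      rwa [Real.sqrt_zero] at this
    have := (hσ.const_mul (45 / 4 * t ^ 2)).add (h2.const_mul (495 / 4 * t ^ 2))
    rwa [mul_zero, mul_zero, add_zero] at this
  have hdiff := squeeze_zero_norm' (f := fun n : ℕ => permCharFun n (t / √(8 * n / 45))
    - Complex.exp
      (-(t ^ 2 / 6 * ((1 + (n : ℝ)⁻¹) * (3 - 2 * (n : ℝ)⁻¹ ^ 2) / (1 - (n : ℝ)⁻¹))) : ℝ)) ?_ herr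
  · simpa using hdiff.add hexp
  filter_upwards [hσ.eventually_le_const (by norm_num : (0 : ℝ) < 1 / 3), eventually_ge_atTop 2]
    with n hn3 hn2
  have hn : (2 : ℝ) ≤ n := by exact_mod_cast hn2
  have hn0 : (n : ℝ) ≠ 0 := by positivity
  have hn1 : (n : ℝ) - 1 ≠ 0 := by
    intro h
    linarith
  set v := t / √(8 * n / 45) with hv
  have hv2 : v ^ 2 = 45 / 8 * t ^ 2 / n := by
    rw [hv, div_pow, Real.sq_sqrt (by positivity)]
    field_simp
  have hle : ∀ j ≤ n, |v / (n * (n - 1)) * (j * (j - 1))| ≤ |v| := by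
    intro j hj
    have hj1 : (j : ℝ) ≤ n := by exact_mod_cast hj
    have hj2 : 0 ≤ (j : ℝ) * (j - 1) := by
      rcases j.eq_zero_or_pos with rfl | h0
      · simp
      · have : (1 : ℝ) ≤ j := by exact_mod_cast h0
        exact mul_nonneg (by linarith) (by linarith)
    have hpos : (0 : ℝ) < n * (n - 1) := mul_pos (by linarith) (by linarith)
    rw [div_mul_eq_mul_div, mul_div_assoc, abs_mul, abs_of_nonneg (div_nonneg hj2 hpos.le)]
    refine mul_le_of_le_one_right (abs_nonneg v) ((div_le_one hpos).2 ?_)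
    nlinarith [j.cast_nonneg (α := ℝ)]
  have key := norm_permCharFun_sub_exp_le (v / (n * (n - 1))) |v| hn3 n hle
  have e1 : v / (n * (n - 1)) * (n * ((n : ℝ) - 1)) = v := by field_simp
  have e2 : 4 / 135 * (v / (n * (n - 1))) ^ 2 * (n * ((n : ℝ) ^ 2 - 1) * (3 * n ^ 2 - 2)) =
      t ^ 2 / 6 * ((1 + (n : ℝ)⁻¹) * (3 - 2 * (n : ℝ)⁻¹ ^ 2) / (1 - (n : ℝ)⁻¹)) := by
    have h3 : 1 - (n : ℝ)⁻¹ ≠ 0 := by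
      rw [show 1 - (n : ℝ)⁻¹ = (n - 1) / n by field_simp]
      exact div_ne_zero hn1 hn0
    rw [div_pow, hv2]
    field_simp
    ring
  have e3 : 2 * |v| ^ 3 * n + 22 * |v| ^ 2 * √n =
      45 / 4 * t ^ 2 * |v| + 495 / 4 * t ^ 2 * √((n : ℝ)⁻¹) := by
    have h4 : √(n : ℝ) ^ 2 = n := Real.sq_sqrt n.cast_nonneg
    have h5 : √(n : ℝ) ≠ 0 := by positivity
    rw [pow_succ |v| 2, sq_abs, hv2, Real.sqrt_inv]
    set r := √(n : ℝ)
    rw [← h4]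
    field_simp
    ring
  rwa [e1, e2, e3] at key

/-- The law of `f i` for a uniformly random index `i`. -/
def uniformLaw {ι : Type*} [Fintype ι] (f : ι → ℝ) : Measure ℝ :=
  ∑ i, (Fintype.card ι : ENNReal)⁻¹ • Measure.dirac (f i)

section UniformLaw

variable {ι : Type*} [Fintype ι] (f : ι → ℝ)

lemma uniformLaw_apply {s : Set ℝ} (hs : MeasurableSet s) :
    uniformLaw f s =
      (Fintype.card ι : ENNReal)⁻¹ * ((Finset.univ.filter (fun i => f i ∈ s)).card : ENNReal) := by
  simp [uniformLaw, Measure.finsetSum_apply, hs, Set.indicator_apply, Finset.sum_ite, mul_comm]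

instance [Nonempty ι] : IsProbabilityMeasure (uniformLaw f) where
  measure_univ := by
    rw [uniformLaw_apply f MeasurableSet.univ]
    simp [ENNReal.inv_mul_cancel]

lemma charFun_uniformLaw (t : ℝ) :
    charFun (uniformLaw f) t =
      (∑ i, Complex.exp ((t * f i : ℝ) * Complex.I)) / (Fintype.card ι : ℂ) := by
  rw [charFun_apply_real, uniformLaw, integral_finsetSum_measure]
  · simp [integral_smul_measure, div_eq_inv_mul, Finset.mul_sum]
  · intro i _
    rcases isEmpty_or_nonempty ι with h | h
    · exact h.elim i
    · exact (integrable_dirac (by simp)).smul_measure (by simp)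

end UniformLaw

/-- for a uniformly random permutation `τₙ` of `{1,…,n}`,
`(LAₙ(τₙ) − 2n/3)/√(8n/45)` converges in distribution to a standard normal
random variable, stated via pointwise convergence of the cumulative
distribution functions (the limit CDF being continuous). -/
theorem stmt2 :
    ∀ x : ℝ,
      Tendsto (fun n : ℕ =>
          ((Finset.univ.filter (fun τ : Equiv.Perm (Fin n) =>
              ((LAfin (fun i => τ i) : ℝ) - 2 * n / 3) / Real.sqrt (8 * n / 45) ≤ x)).card : ℝ)
            / (Fintype.card (Equiv.Perm (Fin n)) : ℝ))
        atTop (nhds ((gaussianReal 0 1 (Set.Iic x)).toReal)) := by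
  intro x
  let W (n : ℕ) (τ : Equiv.Perm (Fin n)) : ℝ := ((permLA τ : ℝ) - 2 * n / 3) / √(8 * n / 45)
  let μ (n : ℕ) : ProbabilityMeasure ℝ := ⟨uniformLaw (W n), inferInstance⟩
  let μ₀ : ProbabilityMeasure ℝ := ⟨gaussianReal 0 1, inferInstance⟩
  have hchar (t : ℝ) :
      Tendsto (fun n => charFun (μ n : Measure ℝ) t) atTop (nhds (charFun (μ₀ : Measure ℝ) t)) := by
    have h0 : charFun (μ₀ : Measure ℝ) t = 1 * Complex.exp (-(t ^ 2 / 2) : ℝ) := by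
      simp [μ₀, charFun_gaussianReal]
    have h1 : Tendsto (fun n : ℕ => Complex.exp ((t / √(8 * n / 45) * (1 / 6) : ℝ) * Complex.I))
        atTop (nhds 1) := by
      have h2 : Tendsto (fun n : ℕ => √(8 * (n : ℝ) / 45)) atTop atTop :=
        Real.tendsto_sqrt_atTop.comp ((tendsto_natCast_atTop_atTop.const_mul_atTop
          (by norm_num)).atTop_div_const (by norm_num))
      have h3 := (h2.const_div_atTop t).mul_const (1 / 6)
      have h4 := (((Complex.continuous_ofReal.tendsto _).comp h3).mul_const Complex.I).cexp
      simpa only [Function.comp_apply, zero_mul, Complex.ofReal_zero, Complex.exp_zero] using h4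
    rw [h0]
    refine (h1.mul (tendsto_permCharFun t)).congr fun n => ?_
    rw [permCharFun, ← permAvg_const_mul]
    simp only [μ, ProbabilityMeasure.coe_mk, charFun_uniformLaw, permAvg, Fintype.card_perm,
      Fintype.card_fin]
    congr 1
    refine Finset.sum_congr rfl fun τ _ => ?_
    rw [← Complex.exp_add, ← add_mul, ← Complex.ofReal_add]
    congr 3
    simp only [W, dev]
    ring
  have hlim := ProbabilityMeasure.tendsto_measure_of_null_frontier_of_tendsto'
    (ProbabilityMeasure.tendsto_of_tendsto_charFun hchar) (E := Set.Iic x) (by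
      rw [frontier_Iic]
      have : NullSingletonClass (μ₀ : Measure ℝ) :=
        nullSingletonClass_gaussianReal one_ne_zero
      exact measure_singleton x)
  refine ((ENNReal.tendsto_toReal (measure_ne_top (μ₀ : Measure ℝ) _)).comp hlim).congr fun n => ?_
  simp only [μ, ProbabilityMeasure.coe_mk, Function.comp_apply,
    uniformLaw_apply _ measurableSet_Iic, Set.mem_Iic, ENNReal.toReal_mul, ENNReal.toReal_inv,
    ENNReal.toReal_natCast]
  rw [div_eq_inv_mul]
  rfl

end
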